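/- Let (x_k)_{k≥2} be a sequence of nonnegative real numbers, and suppose x_k → n and x_k^k → p as k → ∞ (both limits real numbers). Then (k/(k−1))·x_k^{k−1} → p as k → ∞. -/

import Mathlib

open Filter Topology in
theorem tendsto_natCast_div_natCast_sub_one :
    Tendsto (fun k : ℕ => (k : ℝ) / ((k : ℝ) - 1)) atTop (𝓝 1) := by
  simpa [sub_eq_add_neg] using tendsto_natCast_div_add_atTop (𝕜 := ℝ) (-1)

open Filter Topology in
theorem tendsto_pow_zero_of_tendsto_lt_one {ι : Type*} {l : Filter ι} {x : ι → ℝ} {m : ι → ℕ}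
    {n : ℝ} (hx : ∀ i, 0 ≤ x i) (hn : n < 1) (hxn : Tendsto x l (𝓝 n))
    (hm : Tendsto m l atTop) : Tendsto (fun i => x i ^ m i) l (𝓝 0) := by
  obtain ⟨r, hr, hr1⟩ := exists_between (max_lt hn zero_lt_one)
  obtain ⟨hnr, hr0⟩ := max_lt_iff.mp hr
  refine squeeze_zero' (.of_forall fun i => pow_nonneg (hx i) _) ?_
    ((tendsto_pow_atTop_nhds_zero_of_lt_one hr0.le hr1).comp hm)
  filter_upwards [hxn.eventually_lt_const hnr] with i hi
  exact pow_le_pow_left₀ (hx i) hi.le _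

open Filter Topology in
theorem tendsto_pow_atTop_of_tendsto_one_lt {ι : Type*} {l : Filter ι} {x : ι → ℝ} {m : ι → ℕ}
    {n : ℝ} (hn : 1 < n) (hxn : Tendsto x l (𝓝 n)) (hm : Tendsto m l atTop) :
    Tendsto (fun i => x i ^ m i) l atTop := by
  obtain ⟨r, hr1, hrn⟩ := exists_between hn
  refine tendsto_atTop_mono' l ?_ ((tendsto_pow_atTop_atTop_of_one_lt hr1).comp hm)
  filter_upwards [hxn.eventually_const_lt hrn] with i hi
  exact pow_le_pow_left₀ (by linarith) hi.le _

/-- If nonnegative reals `x k` converge to `n` and `x k ^ k → p`, then the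
pressures `(k/(k-1)) * x k ^ (k-1)` converge to the same limit `p`. -/
theorem stmt_7 (x : ℕ → ℝ) (hx : ∀ k, 0 ≤ x k) (n p : ℝ)
    (hxn : Filter.Tendsto x Filter.atTop (nhds n))
    (hxp : Filter.Tendsto (fun k => x k ^ k) Filter.atTop (nhds p)) :
    Filter.Tendsto (fun k : ℕ => ((k : ℝ) / ((k : ℝ) - 1)) * x k ^ (k - 1))
      Filter.atTop (nhds p) := by
  suffices h : Filter.Tendsto (fun k : ℕ => x k ^ (k - 1)) Filter.atTop (nhds p) by
    simpa using tendsto_natCast_div_natCast_sub_one.mul h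
  rcases lt_trichotomy n 1 with hn | rfl | hn
  · obtain rfl : p = 0 := tendsto_nhds_unique hxp
      (tendsto_pow_zero_of_tendsto_lt_one hx hn hxn Filter.tendsto_id)
    exact tendsto_pow_zero_of_tendsto_lt_one hx hn hxn (Filter.tendsto_sub_atTop_nat 1)
  · have h : Filter.Tendsto (fun k => x k ^ k / x k) Filter.atTop (nhds p) := by
      simpa only [div_one, Pi.div_def] using hxp.div hxn one_ne_zero
    refine h.congr' ?_
    filter_upwards [hxn.eventually_ne one_ne_zero, Filter.eventually_ge_atTop 1] with k hk hk1
    rw [div_eq_iff hk, pow_sub_one_mul (by lia)]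
  · exact absurd hxp (not_tendsto_nhds_of_tendsto_atTop
      (tendsto_pow_atTop_of_tendsto_one_lt hn hxn Filter.tendsto_id) p)
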